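/- (A priori stability of BQNL.) Let η : ℤ → [0,1] be N-periodic with β_ξ := η_ξ, let y ∈ 𝒴 with min_ξ y'_ξ ≥ r*/2 > 0, set A̲ := min_ξ A_ξ and C̄_i := C_i(2 min_ξ y'_ξ). Then c_η(y) ≥ A̲ − 2εC̄₃ max_ξ |Δβ_ξ · y''_ξ| − 2ε² ( C̄₃ max_ξ |(1−β_{ξ−1}) y'''_ξ| + C̄₄ max_ξ |(1−β_ξ)(y''_ξ)²| ). -/

import Mathlib

open scoped BigOperators ENNReal
open Finset

noncomputable section

/-- The lattice spacing `ε = 1/N`. -/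
def eps (N : ℕ) : ℝ := (N : ℝ)⁻¹

/-- `u : ℤ → ℝ` is `N`-periodic. -/
def IsPeriodic (N : ℕ) (u : ℤ → ℝ) : Prop := ∀ ξ : ℤ, u (ξ + N) = u ξ

/-- Membership in the space `𝒰` of `N`-periodic mean-zero displacements. -/
def inU (N : ℕ) (u : ℤ → ℝ) : Prop :=
  IsPeriodic N u ∧ ∑ ξ ∈ Finset.Icc (1 : ℤ) (N : ℤ), u ξ = 0

/-- The uniform deformation `y^F_ξ = F ε ξ`. -/
def yUnif (N : ℕ) (F : ℝ) : ℤ → ℝ := fun ξ => F * eps N * ξ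

/-- Membership in the space `𝒴` of admissible deformations. -/
def inY (N : ℕ) (y : ℤ → ℝ) : Prop :=
  ∃ F : ℝ, 0 < F ∧ ∃ u : ℤ → ℝ, inU N u ∧ y = fun ξ => yUnif N F ξ + u ξ

/-- The discrete first derivative `y'_ξ = (y_ξ - y_{ξ-1})/ε`. -/
def d1 (N : ℕ) (y : ℤ → ℝ) (ξ : ℤ) : ℝ := (y ξ - y (ξ - 1)) / eps N

/-- The discrete second derivative `y''_ξ`. -/
def d2 (N : ℕ) (y : ℤ → ℝ) (ξ : ℤ) : ℝ :=
  (y (ξ + 1) - 2 * y ξ + y (ξ - 1)) / (eps N) ^ 2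

/-- The discrete third derivative `y'''_ξ`. -/
def d3 (N : ℕ) (y : ℤ → ℝ) (ξ : ℤ) : ℝ :=
  (y (ξ + 1) - 3 * y ξ + 3 * y (ξ - 1) - y (ξ - 2)) / (eps N) ^ 3

/-- The BQC energy `Φ_{α,β}`. -/
def PhiBQC (N : ℕ) (φ : ℝ → ℝ) (α β : ℤ → ℝ) (y : ℤ → ℝ) : ℝ :=
  eps N * ∑ ξ ∈ Finset.Icc (1 : ℤ) (N : ℤ),
    (φ (d1 N y ξ) + α ξ * φ (2 * d1 N y ξ) + β ξ * φ (d1 N y ξ + d1 N y (ξ + 1)))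

/-- The BQNL energy with blending function `η`. -/
def PhiBQNL (N : ℕ) (φ : ℝ → ℝ) (η : ℤ → ℝ) : (ℤ → ℝ) → ℝ :=
  PhiBQC N φ (fun ξ => 1 - (η ξ + η (ξ - 1)) / 2) η

/-- The BQCE energy with blending function `γ`. -/
def PhiBQCE (N : ℕ) (φ : ℝ → ℝ) (γ : ℤ → ℝ) : (ℤ → ℝ) → ℝ :=
  PhiBQC N φ (fun ξ => (γ ξ + γ (ξ - 1)) / 2) (fun ξ => 1 - (γ (ξ + 1) + γ (ξ - 1)) / 2)

/-- The atomistic energy `Φ`. -/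
def PhiAt (N : ℕ) (φ : ℝ → ℝ) (y : ℤ → ℝ) : ℝ :=
  eps N * ∑ ξ ∈ Finset.Icc (1 : ℤ) (N : ℤ),
    (φ (d1 N y ξ) + φ (d1 N y ξ + d1 N y (ξ + 1)))

/-- The first variation `δΨ(y)[u] = (d/dt)|_{t=0} Ψ(y+tu)`. -/
def fvar (Ψ : (ℤ → ℝ) → ℝ) (y u : ℤ → ℝ) : ℝ :=
  deriv (fun t : ℝ => Ψ (fun ξ => y ξ + t * u ξ)) 0

/-- The second variation `δ²Ψ(y)[u,u] = (d²/dt²)|_{t=0} Ψ(y+tu)`. -/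
def svar (Ψ : (ℤ → ℝ) → ℝ) (y u : ℤ → ℝ) : ℝ :=
  iteratedDeriv 2 (fun t : ℝ => Ψ (fun ξ => y ξ + t * u ξ)) 0

/-- `max_ξ |v_ξ|` (for a periodic sequence this is a genuine maximum). -/
def supAbs (v : ℤ → ℝ) : ℝ := sSup (Set.range fun ξ => |v ξ|)

/-- `min_ξ y'_ξ` (for an admissible deformation this is a genuine minimum). -/
def infD1 (N : ℕ) (y : ℤ → ℝ) : ℝ := sInf (Set.range fun ξ => d1 N y ξ)

/-- The constant `C_i(r₀) = sup_{r ≥ r₀} |φ^(i)(r)|`. -/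
def Cbound (φ : ℝ → ℝ) (i : ℕ) (r₀ : ℝ) : ℝ :=
  sSup ((fun r => |iteratedDeriv i φ r|) '' Set.Ici r₀)

/-- The `ℓ^p_ε` norm over one period, `p ∈ [1,∞]`. -/
def lpnorm (N : ℕ) (p : ℝ≥0∞) (v : ℤ → ℝ) : ℝ :=
  if p = ⊤ then supAbs v
  else (eps N * ∑ ξ ∈ Finset.Icc (1 : ℤ) (N : ℤ), |v ξ| ^ p.toReal) ^ (1 / p.toReal)

/-- The Hessian coefficient `A_ξ` of the atomistic energy. -/
def Acoef (N : ℕ) (φ : ℝ → ℝ) (y : ℤ → ℝ) (ξ : ℤ) : ℝ :=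
  iteratedDeriv 2 φ (d1 N y ξ) + 2 * iteratedDeriv 2 φ (d1 N y ξ + d1 N y (ξ + 1))
    + 2 * iteratedDeriv 2 φ (d1 N y (ξ - 1) + d1 N y ξ)

/-- The Hessian coefficient `Ā_ξ` of the BQC energy. -/
def AbarCoef (N : ℕ) (φ : ℝ → ℝ) (α β : ℤ → ℝ) (y : ℤ → ℝ) (ξ : ℤ) : ℝ :=
  iteratedDeriv 2 φ (d1 N y ξ) + 2 * β ξ * iteratedDeriv 2 φ (d1 N y ξ + d1 N y (ξ + 1))
    + 2 * β (ξ - 1) * iteratedDeriv 2 φ (d1 N y (ξ - 1) + d1 N y ξ)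
    + 4 * α ξ * iteratedDeriv 2 φ (2 * d1 N y ξ)

/-- The coercivity constant `inf { δ²Ψ(y)[u,u] : u ∈ 𝒰, ‖u'‖_{ℓ²_ε} = 1 }`. -/
def coercConst (N : ℕ) (Ψ : (ℤ → ℝ) → ℝ) (y : ℤ → ℝ) : ℝ :=
  sInf { c : ℝ | ∃ u : ℤ → ℝ, inU N u ∧ lpnorm N 2 (d1 N u) = 1 ∧ c = svar Ψ y u }

end

/-! ### Periodic sequences -/

theorem IsPeriodic.periodic {N : ℕ} {f : ℤ → ℝ} (hf : IsPeriodic N f) :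
    Function.Periodic f (N : ℤ) := hf

theorem IsPeriodic.shift {N : ℕ} {f : ℤ → ℝ} (hf : IsPeriodic N f) (k : ℤ) :
    IsPeriodic N (fun ξ => f (ξ + k)) := fun ξ => by
  simp only [show ξ + N + k = ξ + k + N by ring, hf (ξ + k)]

theorem IsPeriodic.finite_range {N : ℕ} (hN : 0 < N) {f : ℤ → ℝ} (hf : IsPeriodic N f) :
    (Set.range f).Finite := by
  refine ((Finset.Ico (0 : ℤ) N).finite_toSet.image f).subset ?_
  rintro _ ⟨ξ, rfl⟩
  have hN' : (0 : ℤ) < N := by exact_mod_cast hN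
  refine ⟨ξ % N, by simpa using ⟨Int.emod_nonneg ξ hN'.ne', Int.emod_lt_of_pos ξ hN'⟩, ?_⟩
  rw [Int.emod_def, mul_comm]
  exact hf.periodic.sub_int_mul_eq _

theorem IsPeriodic.sum_Icc_succ {N : ℕ} {f : ℤ → ℝ} (hf : IsPeriodic N f) :
    ∑ ξ ∈ Finset.Icc (1 : ℤ) N, f (ξ + 1) = ∑ ξ ∈ Finset.Icc (1 : ℤ) N, f ξ := by
  have key : ∀ g : ℤ → ℝ,
      ∑ ξ ∈ Finset.Icc (1 : ℤ) N, g ξ = ∑ i ∈ Finset.range N, g (i + 1) := fun g => by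
    rw [Int.Icc_eq_finset_map, Finset.sum_map]
    simp [add_comm]
  rw [key, key, ← sub_eq_zero, ← Finset.sum_sub_distrib]
  have := Finset.sum_range_sub (fun i : ℕ => f ((i : ℤ) + 1)) N
  push_cast at this
  rw [this, add_comm, hf 1, sub_self]

theorem le_supAbs {N : ℕ} (hN : 0 < N) {v : ℤ → ℝ} (hv : IsPeriodic N v) (ξ : ℤ) :
    |v ξ| ≤ supAbs v :=
  le_csSup (IsPeriodic.finite_range (f := fun ξ => |v ξ|) hN
    fun ζ => congrArg abs (hv ζ)).bddAbove ⟨ξ, rfl⟩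

/-! ### Finite differences -/

theorem eps_pos {N : ℕ} (hN : 0 < N) : 0 < eps N :=
  inv_pos.2 (Nat.cast_pos.2 hN)

theorem d1_add_mul (N : ℕ) (y u : ℤ → ℝ) (t : ℝ) (ξ : ℤ) :
    d1 N (fun ζ => y ζ + t * u ζ) ξ = d1 N y ξ + t * d1 N u ξ := by
  unfold d1
  ring

theorem eps_mul_d2 {N : ℕ} (hN : 0 < N) (y : ℤ → ℝ) (ξ : ℤ) :
    eps N * d2 N y ξ = d1 N y (ξ + 1) - d1 N y ξ := by
  have := (eps_pos hN).ne'
  unfold d1 d2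
  rw [add_sub_cancel_right]
  field_simp
  ring

theorem eps_sq_mul_d3 {N : ℕ} (hN : 0 < N) (y : ℤ → ℝ) (ξ : ℤ) :
    eps N ^ 2 * d3 N y ξ = d1 N y (ξ + 1) - 2 * d1 N y ξ + d1 N y (ξ - 1) := by
  have := (eps_pos hN).ne'
  unfold d1 d3
  rw [add_sub_cancel_right, sub_sub ξ 1 1, one_add_one_eq_two]
  field_simp
  ring

theorem IsPeriodic.d1 {N : ℕ} {u : ℤ → ℝ} (hu : IsPeriodic N u) : IsPeriodic N (d1 N u) :=
  fun ξ => by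
    unfold _root_.d1
    rw [hu ξ, show ξ + N - 1 = ξ - 1 + N by ring, hu (ξ - 1)]

theorem inY.isPeriodic_d1 {N : ℕ} {y : ℤ → ℝ} (hy : inY N y) : IsPeriodic N (d1 N y) := by
  obtain ⟨F, -, u, hu, rfl⟩ := hy
  have key : ∀ ξ, _root_.d1 N (fun ξ => yUnif N F ξ + u ξ) ξ
      = F * eps N / eps N + _root_.d1 N u ξ := fun ξ => by
    unfold _root_.d1 yUnif
    push_cast
    ring
  intro ξ
  rw [key, key, hu.1.d1 ξ]

theorem lpnorm_two_eq_one {N : ℕ} {v : ℤ → ℝ} :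
    lpnorm N 2 v = 1 ↔ eps N * ∑ ξ ∈ Finset.Icc (1 : ℤ) N, v ξ ^ 2 = 1 := by
  simp only [lpnorm, ENNReal.ofNat_ne_top, if_false, ENNReal.toReal_ofNat, Real.rpow_ofNat,
    sq_abs, ← Real.sqrt_eq_rpow, Real.sqrt_eq_one]

/-- A weighted sum of normalized squares is at least any lower bound of the weights. -/
theorem le_eps_mul_sum_mul_sq {N : ℕ} {v : ℤ → ℝ} (hv : lpnorm N 2 v = 1) {a : ℤ → ℝ} {c : ℝ}
    (h : ∀ ξ, c ≤ a ξ) : c ≤ eps N * ∑ ξ ∈ Finset.Icc (1 : ℤ) N, a ξ * v ξ ^ 2 := by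
  rw [lpnorm_two_eq_one] at hv
  calc c = eps N * ∑ ξ ∈ Finset.Icc (1 : ℤ) N, c * v ξ ^ 2 := by
        rw [← Finset.mul_sum, mul_left_comm, hv, mul_one]
    _ ≤ _ := mul_le_mul_of_nonneg_left
        (Finset.sum_le_sum fun ξ _ => mul_le_mul_of_nonneg_right (h ξ) (sq_nonneg _))
        (inv_nonneg.2 (Nat.cast_nonneg N))

/-- There are displacements with normalized gradient as soon as there are two lattice sites. -/
theorem exists_inU_lpnorm_d1_eq_one {N : ℕ} (hN : 2 ≤ N) :
    ∃ u : ℤ → ℝ, inU N u ∧ lpnorm N 2 (d1 N u) = 1 := by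
  classical
  have hN0 : (N : ℝ) ≠ 0 := by positivity
  let v : ℤ → ℝ := fun ξ => if (N : ℤ) ∣ ξ then 1 else 0
  have hv : IsPeriodic N v := fun ξ => by simp [v]
  let m : ℝ := (∑ ξ ∈ Finset.Icc (1 : ℤ) N, v ξ) / N
  let S : ℝ := eps N * ∑ ξ ∈ Finset.Icc (1 : ℤ) N, d1 N v ξ ^ 2
  have hε := eps_pos (show 0 < N by omega)
  have hv1 : v 1 = 0 := by
    refine if_neg fun h => ?_
    have := Int.le_of_dvd one_pos h
    omega
  have hd : d1 N v 1 ≠ 0 := by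
    have hv0 : v (1 - 1) = 1 := by simp [v]
    rw [d1, hv0, hv1]
    exact div_ne_zero (by norm_num) hε.ne'
  have hS : 0 < S := mul_pos hε <| Finset.sum_pos' (fun _ _ => sq_nonneg _)
    ⟨1, Finset.mem_Icc.2 ⟨le_rfl, by omega⟩, by positivity⟩
  refine ⟨fun ξ => (√S)⁻¹ * (v ξ - m), ⟨fun ξ => by simp only [hv ξ], ?_⟩, ?_⟩
  · rw [← Finset.mul_sum, Finset.sum_sub_distrib]
    simp [m, mul_div_cancel₀ _ hN0]
  · have key : ∀ ξ, d1 N (fun ξ => (√S)⁻¹ * (v ξ - m)) ξ = (√S)⁻¹ * d1 N v ξ := fun ξ => by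
      unfold d1
      ring
    rw [lpnorm_two_eq_one]
    simp only [key, mul_pow, ← Finset.mul_sum]
    rw [mul_left_comm, inv_pow, Real.sq_sqrt hS.le]
    exact inv_mul_cancel₀ hS.ne'

/-! ### Calculus -/

/-- Second-order Taylor estimate on a half-line. -/
theorem abs_sub_sub_mul_le_of_hasDerivAt {f f' f'' : ℝ → ℝ} {m C : ℝ}
    (hf : ∀ x, m ≤ x → HasDerivAt f (f' x) x) (hf' : ∀ x, m ≤ x → HasDerivAt f' (f'' x) x)
    (hC : ∀ x, m ≤ x → |f'' x| ≤ C) {x h : ℝ} (hx : m ≤ x) (hxh : m ≤ x + h) :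
    |f (x + h) - f x - f' x * h| ≤ C / 2 * h ^ 2 := by
  have hmem : ∀ t ∈ Set.Icc (0 : ℝ) 1, m ≤ x + t * h := fun t ht => by
    nlinarith [ht.1, ht.2]
  have hlip : ∀ z, m ≤ z → |f' z - f' x| ≤ C * |z - x| := fun z hz =>
    (convex_Ici m).norm_image_sub_le_of_norm_hasDerivWithin_le
      (fun w hw => (hf' w hw).hasDerivWithinAt) (fun w hw => hC w hw) hx hz
  have hline : ∀ t, HasDerivAt (fun t : ℝ => x + t * h) h t := fun t => by
    simpa using ((hasDerivAt_id t).mul_const h).const_add x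
  have hF : ∀ t ∈ Set.Icc (0 : ℝ) 1,
      HasDerivAt (fun t => f (x + t * h) - f x - f' x * (t * h))
        (f' (x + t * h) * h - f' x * h) t := fun t ht => by
    exact (((hf _ (hmem t ht)).comp t (hline t)).sub_const (f x)).fun_sub
      ((hasDerivAt_mul_const h).const_mul (f' x))
  have key := image_norm_le_of_norm_deriv_right_le_deriv_boundary (a := (0 : ℝ)) (b := 1)
    (B := fun t => C / 2 * h ^ 2 * t ^ 2) (B' := fun t => C * h ^ 2 * t)
    (fun t ht => (hF t ht).continuousAt.continuousWithinAt)
    (fun t ht => (hF t (Set.Ico_subset_Icc_self ht)).hasDerivWithinAt)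
    (by simp)
    (fun t => ((hasDerivAt_pow 2 t).const_mul (C / 2 * h ^ 2)).congr_deriv (by
      norm_num
      ring))
    (fun t ht => by
      have h1 := hlip _ (hmem t (Set.Ico_subset_Icc_self ht))
      rw [add_sub_cancel_left, abs_mul, abs_of_nonneg ht.1] at h1
      rw [← sub_mul, Real.norm_eq_abs, abs_mul]
      calc _ ≤ C * (t * |h|) * |h| := by gcongr
        _ = C * |h| ^ 2 * t := by ring
        _ = C * h ^ 2 * t := by rw [sq_abs])
    (Set.right_mem_Icc.2 zero_le_one)
  simpa using key

theorem ContDiffOn.hasDerivAt_iteratedDeriv {φ : ℝ → ℝ} {s : Set ℝ} {n i : ℕ}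
    (hφ : ContDiffOn ℝ n φ s) (hs : IsOpen s) (hi : i < n) {x : ℝ} (hx : x ∈ s) :
    HasDerivAt (iteratedDeriv i φ) (iteratedDeriv (i + 1) φ x) x := by
  have h := ((hφ.contDiffAt (hs.mem_nhds hx)).contDiffWithinAt
    (s := Set.univ)).differentiableWithinAt_iteratedDerivWithin (m := i)
    (by exact_mod_cast hi) (by simp)
  rw [iteratedDerivWithin_univ, differentiableWithinAt_univ] at h
  rw [iteratedDeriv_succ]
  exact h.hasDerivAt

theorem iteratedDeriv_two_comp_affine {φ : ℝ → ℝ} {s : Set ℝ} (hs : IsOpen s)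
    (hφ : ContDiffOn ℝ 2 φ s) {a : ℝ} (ha : a ∈ s) (b : ℝ) :
    iteratedDeriv 2 (fun t => φ (a + t * b)) 0 = iteratedDeriv 2 φ a * b ^ 2 := by
  have hline : ∀ t, HasDerivAt (fun t : ℝ => a + t * b) b t := fun t => by
    simpa using ((hasDerivAt_id t).mul_const b).const_add a
  have ha0 : a + 0 * b ∈ s := by simpa using ha
  have hev : ∀ᶠ t in nhds (0 : ℝ), a + t * b ∈ s :=
    (hline 0).continuousAt.eventually (hs.mem_nhds ha0)
  have h1 : deriv (fun t => φ (a + t * b)) =ᶠ[nhds 0]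
      fun t => iteratedDeriv 1 φ (a + t * b) * b := by
    filter_upwards [hev] with t ht
    have := hφ.hasDerivAt_iteratedDeriv (n := 2) hs (i := 0) (by norm_num) ht
    rw [iteratedDeriv_zero] at this
    exact (this.comp t (hline t)).deriv
  rw [iteratedDeriv_succ, iteratedDeriv_one, h1.deriv_eq]
  have := hφ.hasDerivAt_iteratedDeriv (n := 2) hs (i := 1) (by norm_num) ha0
  refine ((this.comp (0 : ℝ) (hline 0)).mul_const b).deriv.trans ?_
  rw [zero_mul, add_zero]
  ring

theorem abs_iteratedDeriv_le_Cbound {φ : ℝ → ℝ} {i : ℕ} {r₀ r : ℝ}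
    (h : BddAbove ((fun r => |iteratedDeriv i φ r|) '' Set.Ici r₀)) (hr : r₀ ≤ r) :
    |iteratedDeriv i φ r| ≤ Cbound φ i r₀ :=
  le_csSup h ⟨r, hr, rfl⟩

/-! ### The second variation of the blended energies -/

theorem svar_PhiBQC {N : ℕ} {φ : ℝ → ℝ} (hφ : ContDiffOn ℝ 2 φ (Set.Ioi 0)) (α β : ℤ → ℝ)
    {y : ℤ → ℝ} (hy : ∀ ξ, 0 < d1 N y ξ) (u : ℤ → ℝ) :
    svar (PhiBQC N φ α β) y u = eps N * ∑ ξ ∈ Finset.Icc (1 : ℤ) N,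
      (iteratedDeriv 2 φ (d1 N y ξ) * d1 N u ξ ^ 2
        + α ξ * (iteratedDeriv 2 φ (2 * d1 N y ξ) * (2 * d1 N u ξ) ^ 2)
        + β ξ * (iteratedDeriv 2 φ (d1 N y ξ + d1 N y (ξ + 1))
            * (d1 N u ξ + d1 N u (ξ + 1)) ^ 2)) := by
  have hcd : ∀ a b : ℝ, 0 < a → ContDiffAt ℝ (2 : ℕ) (fun t : ℝ => φ (a + t * b)) 0 :=
    fun a b ha => ContDiffAt.comp (0 : ℝ) (g := φ) (f := fun t : ℝ => a + t * b)
      (hφ.contDiffAt (Ioi_mem_nhds (by simpa using ha))) (by fun_prop)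
  have hc : ∀ a b c : ℝ, 0 < a → ContDiffAt ℝ (2 : ℕ) (fun t : ℝ => c * φ (a + t * b)) 0 :=
    fun a b c ha => contDiffAt_const.mul (hcd a b ha)
  have heq : ∀ t : ℝ, PhiBQC N φ α β (fun ξ => y ξ + t * u ξ)
      = eps N * ∑ ξ ∈ Finset.Icc (1 : ℤ) N,
        (φ (d1 N y ξ + t * d1 N u ξ) + α ξ * φ (2 * d1 N y ξ + t * (2 * d1 N u ξ))
          + β ξ * φ (d1 N y ξ + d1 N y (ξ + 1) + t * (d1 N u ξ + d1 N u (ξ + 1)))) := fun t => by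
    simp only [PhiBQC, d1_add_mul]
    congr 1
    refine Finset.sum_congr rfl fun ξ _ => ?_
    rw [mul_add, mul_left_comm, add_add_add_comm, ← mul_add t]
  have h2 : ∀ ξ, 0 < 2 * d1 N y ξ := fun ξ => mul_pos two_pos (hy ξ)
  have h3 : ∀ ξ, 0 < d1 N y ξ + d1 N y (ξ + 1) := fun ξ => add_pos (hy _) (hy _)
  simp only [svar, heq, iteratedDeriv_const_mul_field]
  rw [iteratedDeriv_fun_sum fun ξ _ =>
    ((hcd _ _ (hy ξ)).add (hc _ _ _ (h2 ξ))).add (hc _ _ _ (h3 ξ))]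
  congr 1
  refine Finset.sum_congr rfl fun ξ _ => ?_
  rw [iteratedDeriv_fun_add ((hcd _ _ (hy ξ)).add (hc _ _ _ (h2 ξ))) (hc _ _ _ (h3 ξ)),
    iteratedDeriv_fun_add (hcd _ _ (hy ξ)) (hc _ _ _ (h2 ξ)), iteratedDeriv_const_mul_field,
    iteratedDeriv_const_mul_field, iteratedDeriv_two_comp_affine isOpen_Ioi hφ (hy ξ),
    iteratedDeriv_two_comp_affine isOpen_Ioi hφ (h2 ξ),
    iteratedDeriv_two_comp_affine isOpen_Ioi hφ (h3 ξ)]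

/-- If next-nearest neighbours interact in the concave region, the second variation is bounded
below by its diagonal part. -/
theorem sum_AbarCoef_mul_sq_le_svar {N : ℕ} {φ : ℝ → ℝ} (hφ : ContDiffOn ℝ 2 φ (Set.Ioi 0))
    (α : ℤ → ℝ) {β : ℤ → ℝ} (hβper : IsPeriodic N β) (hβ : ∀ ξ, 0 ≤ β ξ)
    {y : ℤ → ℝ} (hyper : IsPeriodic N (d1 N y)) (hy : ∀ ξ, 0 < d1 N y ξ)
    (hneg : ∀ ξ, iteratedDeriv 2 φ (d1 N y ξ + d1 N y (ξ + 1)) ≤ 0)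
    {u : ℤ → ℝ} (hu : IsPeriodic N u) :
    eps N * ∑ ξ ∈ Finset.Icc (1 : ℤ) N, AbarCoef N φ α β y ξ * d1 N u ξ ^ 2
      ≤ svar (PhiBQC N φ α β) y u := by
  rw [svar_PhiBQC hφ α β hy u]
  refine mul_le_mul_of_nonneg_left ?_ (inv_nonneg.2 (Nat.cast_nonneg N))
  let g : ℤ → ℝ := fun ξ =>
    2 * β (ξ - 1) * iteratedDeriv 2 φ (d1 N y (ξ - 1) + d1 N y ξ) * d1 N u ξ ^ 2
  have hg : IsPeriodic N g := fun ξ => by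
    simp only [g, show ξ + N - 1 = ξ - 1 + N by ring, hβper (ξ - 1), hyper (ξ - 1), hyper ξ,
      hu.d1 ξ]
  calc _ = ∑ ξ ∈ Finset.Icc (1 : ℤ) N, (AbarCoef N φ α β y ξ * d1 N u ξ ^ 2 - g ξ)
        + ∑ ξ ∈ Finset.Icc (1 : ℤ) N, g (ξ + 1) := by
        rw [hg.sum_Icc_succ, ← Finset.sum_add_distrib]
        simp
    _ ≤ _ := by
        rw [← Finset.sum_add_distrib]
        refine Finset.sum_le_sum fun ξ _ => ?_
        have := mul_nonneg (mul_nonneg (hβ ξ) (neg_nonneg.2 (hneg ξ)))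
          (sq_nonneg (d1 N u ξ - d1 N u (ξ + 1)))
        simp only [g, AbarCoef, add_sub_cancel_right]
        linarith

/-- Comparison of the BQNL and the atomistic Hessian coefficients. -/
theorem Acoef_sub_le_AbarCoef {N : ℕ} (hN : 0 < N) {φ : ℝ → ℝ}
    (hφ : ContDiffOn ℝ 4 φ (Set.Ioi 0)) {m C₃ C₄ : ℝ} (hm : 0 < m)
    (hC₃ : ∀ r, m ≤ r → |iteratedDeriv 3 φ r| ≤ C₃)
    (hC₄ : ∀ r, m ≤ r → |iteratedDeriv 4 φ r| ≤ C₄)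
    {β : ℤ → ℝ} (hβ : ∀ ξ, β ξ ≤ 1) {y : ℤ → ℝ} (hy : ∀ ξ, m ≤ 2 * d1 N y ξ) (ξ : ℤ) :
    Acoef N φ y ξ - 2 * eps N * C₃ * |(β ξ - β (ξ - 1)) * d2 N y ξ|
        - 2 * eps N ^ 2 * (C₃ * |(1 - β (ξ - 1)) * d3 N y ξ|)
        - eps N ^ 2 * (C₄ * |(1 - β ξ) * d2 N y ξ ^ 2|
          + C₄ * |(1 - β (ξ - 1)) * d2 N y (ξ - 1) ^ 2|)
      ≤ AbarCoef N φ (fun ξ => 1 - (β ξ + β (ξ - 1)) / 2) β y ξ := by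
  have hε := eps_pos hN
  have hder : ∀ i < 4, ∀ x, m ≤ x →
      HasDerivAt (iteratedDeriv i φ) (iteratedDeriv (i + 1) φ x) x := fun i hi x hx =>
    hφ.hasDerivAt_iteratedDeriv (n := 4) isOpen_Ioi hi (hm.trans_le hx)
  have h2 := eps_mul_d2 hN y ξ
  have h2' := eps_mul_d2 hN y (ξ - 1)
  rw [sub_add_cancel] at h2'
  have h3 := eps_sq_mul_d3 hN y ξ
  have taylor : ∀ {x h : ℝ}, m ≤ x → m ≤ x + h → |iteratedDeriv 2 φ (x + h)
      - iteratedDeriv 2 φ x - iteratedDeriv 3 φ x * h| ≤ C₄ / 2 * h ^ 2 :=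
    fun hx hxh => abs_sub_sub_mul_le_of_hasDerivAt (hder 2 (by norm_num))
      (hder 3 (by norm_num)) hC₄ hx hxh
  have e1 : 2 * d1 N y ξ + eps N * d2 N y ξ = d1 N y ξ + d1 N y (ξ + 1) := by rw [h2]; ring
  have e2 : 2 * d1 N y ξ + -(eps N * d2 N y (ξ - 1)) = d1 N y (ξ - 1) + d1 N y ξ := by
    rw [h2']; ring
  have t1 := taylor (h := eps N * d2 N y ξ) (hy ξ)
    (by rw [e1]; linarith [hy ξ, hy (ξ + 1)])
  have t2 := taylor (h := -(eps N * d2 N y (ξ - 1))) (hy ξ)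
    (by rw [e2]; linarith [hy ξ, hy (ξ - 1)])
  rw [e1] at t1
  rw [e2] at t2
  have b1 := sub_nonneg.2 (hβ ξ)
  have b2 := sub_nonneg.2 (hβ (ξ - 1))
  have s1 := mul_le_mul_of_nonneg_left (abs_le.1 t1).2 b1
  have s2 := mul_le_mul_of_nonneg_left (abs_le.1 t2).2 b2
  rw [abs_of_nonneg (mul_nonneg b1 (sq_nonneg (d2 N y ξ))),
    abs_of_nonneg (mul_nonneg b2 (sq_nonneg (d2 N y (ξ - 1))))]
  have hX : ∀ X : ℝ, iteratedDeriv 3 φ (2 * d1 N y ξ) * X ≤ C₃ * |X| := fun X =>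
    (le_abs_self _).trans (by rw [abs_mul]; gcongr; exact hC₃ _ (hy ξ))
  have p1 := mul_le_mul_of_nonneg_left (hX (-((β ξ - β (ξ - 1)) * d2 N y ξ))) hε.le
  have p2 := mul_le_mul_of_nonneg_left (hX ((1 - β (ξ - 1)) * d3 N y ξ)) (sq_nonneg (eps N))
  rw [abs_neg] at p1
  have h4 : eps N ^ 2 * d3 N y ξ = eps N * d2 N y ξ - eps N * d2 N y (ξ - 1) := by
    rw [h2, h2', h3]; ring
  have p3 : eps N ^ 2 * (iteratedDeriv 3 φ (2 * d1 N y ξ) * ((1 - β (ξ - 1)) * d3 N y ξ))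
      = iteratedDeriv 3 φ (2 * d1 N y ξ) * (1 - β (ξ - 1))
        * (eps N * d2 N y ξ - eps N * d2 N y (ξ - 1)) := by
    rw [← h4]; ring
  simp only [Acoef, AbarCoef]
  linarith

/-- A priori stability of BQNL. -/
theorem apriori_stability_bqnl
    (N : ℕ) (hN : 5 ≤ N) (φ : ℝ → ℝ) (hφ : ContDiffOn ℝ 4 φ (Set.Ioi 0))
    (hC : ∀ i ≤ 4, ∀ r₀ : ℝ, 0 < r₀ →
      BddAbove ((fun r => |iteratedDeriv i φ r|) '' Set.Ici r₀))
    (rstar : ℝ) (hrstar : 0 < rstar)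
    (hconvex : ∀ r : ℝ, 0 < r → r < rstar → 0 < iteratedDeriv 2 φ r)
    (hconcave : ∀ r : ℝ, rstar < r → iteratedDeriv 2 φ r < 0)
    (η : ℤ → ℝ) (hηper : IsPeriodic N η) (hη01 : ∀ ξ, η ξ ∈ Set.Icc (0 : ℝ) 1)
    (β : ℤ → ℝ) (hβ : β = η)
    (y : ℤ → ℝ) (hy : inY N y) (hy' : rstar / 2 ≤ infD1 N y) :
    sInf (Set.range fun ξ => Acoef N φ y ξ)
        - 2 * eps N * Cbound φ 3 (2 * infD1 N y) *
            supAbs (fun ξ => (β ξ - β (ξ - 1)) * d2 N y ξ)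
        - 2 * (eps N) ^ 2 *
            (Cbound φ 3 (2 * infD1 N y) * supAbs (fun ξ => (1 - β (ξ - 1)) * d3 N y ξ)
              + Cbound φ 4 (2 * infD1 N y) *
                  supAbs (fun ξ => (1 - β ξ) * (d2 N y ξ) ^ 2))
      ≤ coercConst N (PhiBQNL N φ η) y := by
  subst hβ
  have hN0 : 0 < N := by omega
  have hε := eps_pos hN0
  have hyper := hy.isPeriodic_d1
  set m := infD1 N y
  have hmy : ∀ ξ, m ≤ d1 N y ξ := fun ξ =>
    csInf_le (hyper.finite_range hN0).bddBelow ⟨ξ, rfl⟩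
  have hm0 : 0 < 2 * m := by linarith
  have hφ2 : ContDiffOn ℝ 2 φ (Set.Ioi 0) := hφ.of_le (by norm_num)
  have hnonpos : ∀ r, rstar ≤ r → iteratedDeriv 2 φ r ≤ 0 := fun r hr => by
    have hcont := (hφ.hasDerivAt_iteratedDeriv (n := 4) isOpen_Ioi (i := 2) (by norm_num)
      (show r ∈ Set.Ioi 0 from hrstar.trans_le hr)).continuousAt
    refine le_of_tendsto (hcont.tendsto.mono_left (nhdsWithin_le_nhds (s := Set.Ioi r))) ?_
    filter_upwards [self_mem_nhdsWithin] with x hx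
    exact (hconcave x (hr.trans_lt hx)).le
  have hC₃ : ∀ r, 2 * m ≤ r → |iteratedDeriv 3 φ r| ≤ Cbound φ 3 (2 * m) := fun r =>
    abs_iteratedDeriv_le_Cbound (hC 3 (by norm_num) _ hm0)
  have hC₄ : ∀ r, 2 * m ≤ r → |iteratedDeriv 4 φ r| ≤ Cbound φ 4 (2 * m) := fun r =>
    abs_iteratedDeriv_le_Cbound (hC 4 le_rfl _ hm0)
  have hC₃0 := (abs_nonneg _).trans (hC₃ _ le_rfl)
  have hC₄0 := (abs_nonneg _).trans (hC₄ _ le_rfl)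
  have hA : IsPeriodic N (Acoef N φ y) := fun ξ => by
    simp only [Acoef, show ξ + N - 1 = ξ - 1 + N by ring, show ξ + N + 1 = ξ + 1 + N by ring,
      hyper (ξ - 1), hyper (ξ + 1), hyper ξ]
  have hβ' : IsPeriodic N fun ξ => β (ξ - 1) := hηper.shift (-1)
  have hd2 : IsPeriodic N (d2 N y) := fun ξ => by
    refine mul_left_cancel₀ hε.ne' ?_
    rw [eps_mul_d2 hN0, eps_mul_d2 hN0, show ξ + N + 1 = ξ + 1 + N by ring, hyper, hyper]
  have hd3 : IsPeriodic N (d3 N y) := fun ξ => by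
    refine mul_left_cancel₀ (pow_ne_zero 2 hε.ne') ?_
    rw [eps_sq_mul_d3 hN0, eps_sq_mul_d3 hN0, show ξ + N + 1 = ξ + 1 + N by ring,
      show ξ + N - 1 = ξ - 1 + N by ring, hyper, hyper, hyper]
  have m1 := le_supAbs (v := fun ξ => (β ξ - β (ξ - 1)) * d2 N y ξ) hN0
    fun ξ => by simp only [hηper ξ, hβ' ξ, hd2 ξ]
  have m2 := le_supAbs (v := fun ξ => (1 - β (ξ - 1)) * d3 N y ξ) hN0
    fun ξ => by simp only [hβ' ξ, hd3 ξ]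
  have m3 := le_supAbs (v := fun ξ => (1 - β ξ) * d2 N y ξ ^ 2) hN0
    fun ξ => by simp only [hηper ξ, hd2 ξ]
  obtain ⟨u₀, hu₀, hu₀'⟩ := exists_inU_lpnorm_d1_eq_one (show 2 ≤ N by omega)
  refine le_csInf ⟨_, u₀, hu₀, hu₀', rfl⟩ ?_
  rintro _ ⟨u, hu, hu1, rfl⟩
  refine le_trans ?_ (sum_AbarCoef_mul_sq_le_svar hφ2 _ hηper (fun ξ => (hη01 ξ).1) hyper
    (fun ξ => by linarith [hmy ξ])
    (fun ξ => hnonpos _ (by linarith [hmy ξ, hmy (ξ + 1)])) hu.1)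
  refine le_eps_mul_sum_mul_sq hu1 fun ξ => ?_
  refine le_trans ?_ (Acoef_sub_le_AbarCoef hN0 hφ hm0 hC₃ hC₄ (fun ξ => (hη01 ξ).2)
    (fun ξ => by linarith [hmy ξ]) ξ)
  have a0 : sInf (Set.range fun ξ => Acoef N φ y ξ) ≤ Acoef N φ y ξ :=
    csInf_le (hA.finite_range hN0).bddBelow ⟨ξ, rfl⟩
  have a1 := mul_le_mul_of_nonneg_left (m1 ξ)
    (show 0 ≤ 2 * eps N * Cbound φ 3 (2 * m) by positivity)
  have a2 := mul_le_mul_of_nonneg_left (m2 ξ)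
    (show 0 ≤ 2 * eps N ^ 2 * Cbound φ 3 (2 * m) by positivity)
  have a3 := mul_le_mul_of_nonneg_left (m3 ξ)
    (show 0 ≤ eps N ^ 2 * Cbound φ 4 (2 * m) by positivity)
  have a4 := mul_le_mul_of_nonneg_left (m3 (ξ - 1))
    (show 0 ≤ eps N ^ 2 * Cbound φ 4 (2 * m) by positivity)
  linarith
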